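/- Let λ ≥ 0, let X and Y be mm-spaces with μ_X(X) = μ_Y(Y), and let 0 < α ≤ 1. Then α·H̲_λLι_1(X,Y) ≤ H̲_λLι_1(αX, αY) ≤ H̲_λLι_1(X,Y), where αX := (X, d_X, α·μ_X) and αY := (Y, d_Y, α·μ_Y). -/

import Mathlib

open MeasureTheory Set Filter Topology

noncomputable section

/-- Lebesgue measure restricted to the interval `[0, m]`. -/
def lebIcc (m : ℝ) : Measure ℝ := volume.restrict (Icc 0 m)

/-- `φ : [0,m] → X` is a parameter of the mm-space `(X, d_X, μX)`:
a Borel measurable map pushing Lebesgue measure on `[0,m]` forward to `μX`. -/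
def IsParameter {X : Type*} [MeasurableSpace X] (μX : Measure X) (m : ℝ) (φ : ℝ → X) : Prop :=
  Measurable φ ∧ Measure.map φ (lebIcc m) = μX

/-- The pullback `φ*d_X` of the distance of `X` under `φ`. -/
def pb {X : Type*} [PseudoMetricSpace X] (φ : ℝ → X) : ℝ → ℝ → ℝ :=
  fun s t => dist (φ s) (φ t)

/-- The distance `□_λ(d₁, d₂)` between two maps `d₁ d₂ : α × α → ℝ` over a finite
measure space `(α, μ)`. -/
def boxDist {α : Type*} [MeasurableSpace α] (μ : Measure α) (lam : ℝ)
    (d₁ d₂ : α → α → ℝ) : ℝ :=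
  sInf {ε : ℝ | 0 < ε ∧ ∃ T : Set α, MeasurableSet T ∧
    (μ univ).toReal - lam * ε ≤ (μ T).toReal ∧
    ∀ x ∈ T, ∀ y ∈ T, |d₁ x y - d₂ x y| ≤ ε}

/-- `inf □_λ(φX*d_X, φY*d_Y)` over all parameters, for mm-spaces of equal total mass `m`. -/
def boxInf {X Y : Type*} [PseudoMetricSpace X] [MeasurableSpace X]
    [PseudoMetricSpace Y] [MeasurableSpace Y] (lam m : ℝ)
    (μX : Measure X) (μY : Measure Y) : ℝ :=
  sInf {r : ℝ | ∃ (φX : ℝ → X) (φY : ℝ → Y), IsParameter μX m φX ∧ IsParameter μY m φY ∧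
    r = boxDist (lebIcc m) lam (pb φX) (pb φY)}

open Classical in
/-- Gromov's box distance `□̲_λ(X, Y)` between mm-spaces. -/
def mmBox {X Y : Type*} [PseudoMetricSpace X] [MeasurableSpace X]
    [PseudoMetricSpace Y] [MeasurableSpace Y] (lam : ℝ)
    (μX : Measure X) (μY : Measure Y) : ℝ :=
  if (μX univ).toReal = (μY univ).toReal then
    boxInf lam (μX univ).toReal μX μY
  else if (μX univ).toReal < (μY univ).toReal then
    boxInf lam (μX univ).toReal μX
      ((ENNReal.ofReal ((μX univ).toReal / (μY univ).toReal)) • μY)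
      + ((μY univ).toReal - (μX univ).toReal)
  else
    boxInf lam (μY univ).toReal
      ((ENNReal.ofReal ((μY univ).toReal / (μX univ).toReal)) • μX) μY
      + ((μX univ).toReal - (μY univ).toReal)

/-- The measure `μ̲_r` on `r × r` real matrices: the pushforward of `μ^r` under
`(x₁, …, x_r) ↦ (d(x_i, x_j))_{i,j}`, for a (pseudo)distance `d`. -/
def matMeasure {α : Type*} [MeasurableSpace α] (μ : Measure α) (d : α → α → ℝ) (r : ℕ) :
    Measure (Fin r → Fin r → ℝ) :=
  Measure.map (fun x : Fin r → α => fun i j => d (x i) (x j)) (Measure.pi fun _ : Fin r => μ)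

/-- The support of a Borel measure. -/
def msupport {X : Type*} [TopologicalSpace X] [MeasurableSpace X] (μ : Measure X) : Set X :=
  {x | ∀ U : Set X, IsOpen U → x ∈ U → 0 < μ U}

/-- Two mm-spaces are isomorphic: there is a measure preserving isometry (bijective)
between the supports of their measures. -/
def MMIsom {X Y : Type*} [MetricSpace X] [MeasurableSpace X] [MetricSpace Y] [MeasurableSpace Y]
    (μX : Measure X) (μY : Measure Y) : Prop :=
  ∃ f : msupport μX → msupport μY, Function.Bijective f ∧ Isometry f ∧
    Measure.map f (Measure.comap Subtype.val μX) = Measure.comap Subtype.val μY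

/-- The distance `me_λ` on the space of all real valued functions on `(α, μ)`. -/
def meDist {α : Type*} [MeasurableSpace α] (μ : Measure α) (lam : ℝ) (f g : α → ℝ) : ℝ :=
  sInf {ε : ℝ | 0 < ε ∧ (μ {x | ε ≤ |f x - g x|}).toReal ≤ lam * ε}

/-- The distance `me₁` for maps into a metric space. -/
def meDistMap {α Y : Type*} [MeasurableSpace α] [PseudoMetricSpace Y]
    (μ : Measure α) (f g : α → Y) : ℝ :=
  sInf {ε : ℝ | 0 < ε ∧ (μ {x | ε ≤ dist (f x) (g x)}).toReal ≤ ε}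

/-- `Lip_1(d)`: the real valued functions that are `1`-Lipschitz w.r.t. a semi-distance `d`. -/
def Lip1 {α : Type*} (d : α → α → ℝ) : Set (α → ℝ) := {f | ∀ x y, |f x - f y| ≤ d x y}

/-- `d` is a semi-distance function. -/
structure IsSemiDist {α : Type*} (d : α → α → ℝ) : Prop where
  refl : ∀ x, d x x = 0
  symm : ∀ x y, d x y = d y x
  triangle : ∀ x y z, d x z ≤ d x y + d y z

/-- `H_λLι₁(d, d')`: the Hausdorff distance between `Lip_1(d)` and `Lip_1(d')` in
`(𝓕(α, ℝ), me_λ)`. -/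
def HL {α : Type*} [MeasurableSpace α] (μ : Measure α) (lam : ℝ) (d d' : α → α → ℝ) : ℝ :=
  sInf {ε : ℝ | 0 < ε ∧ (∀ f ∈ Lip1 d, ∃ g ∈ Lip1 d', meDist μ lam f g ≤ ε) ∧
    (∀ g ∈ Lip1 d', ∃ f ∈ Lip1 d, meDist μ lam f g ≤ ε)}

/-- `inf H_λLι₁(φX*d_X, φY*d_Y)` over all parameters, for mm-spaces of equal total mass `m`. -/
def obsInf {X Y : Type*} [PseudoMetricSpace X] [MeasurableSpace X]
    [PseudoMetricSpace Y] [MeasurableSpace Y] (lam m : ℝ)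
    (μX : Measure X) (μY : Measure Y) : ℝ :=
  sInf {r : ℝ | ∃ (φX : ℝ → X) (φY : ℝ → Y), IsParameter μX m φX ∧ IsParameter μY m φY ∧
    r = HL (lebIcc m) lam (pb φX) (pb φY)}

open Classical in
/-- Gromov's observable distance `H̲_λLι₁(X, Y)` between mm-spaces. -/
def mmObs {X Y : Type*} [PseudoMetricSpace X] [MeasurableSpace X]
    [PseudoMetricSpace Y] [MeasurableSpace Y] (lam : ℝ)
    (μX : Measure X) (μY : Measure Y) : ℝ :=
  if (μX univ).toReal = (μY univ).toReal then
    obsInf lam (μX univ).toReal μX μY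
  else if (μX univ).toReal < (μY univ).toReal then
    obsInf lam (μX univ).toReal μX
      ((ENNReal.ofReal ((μX univ).toReal / (μY univ).toReal)) • μY)
      + ((μY univ).toReal - (μX univ).toReal)
  else
    obsInf lam (μY univ).toReal
      ((ENNReal.ofReal ((μY univ).toReal / (μX univ).toReal)) • μX) μY
      + ((μX univ).toReal - (μY univ).toReal)

/-- `f : X → Y` is `λ`-Lipschitz up to `ε`. -/
def LipUpTo {X Y : Type*} [PseudoMetricSpace X] [PseudoMetricSpace Y] [MeasurableSpace X]
    (μX : Measure X) (lam ε : ℝ) (f : X → Y) : Prop :=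
  ∃ X₀ : Set X, MeasurableSet X₀ ∧ (μX X₀ᶜ).toReal ≤ ε ∧
    ∀ x ∈ X₀, ∀ x' ∈ X₀, dist (f x) (f x') ≤ lam * dist x x' + ε

/-- Weak convergence of a sequence of finite Borel measures: convergence of integrals of
all bounded continuous functions. -/
def WeakConv {Y : Type*} [TopologicalSpace Y] [MeasurableSpace Y]
    (μs : ℕ → Measure Y) (μ : Measure Y) : Prop :=
  ∀ g : BoundedContinuousFunction Y ℝ,
    Tendsto (fun n => ∫ y, g y ∂(μs n)) atTop (𝓝 (∫ y, g y ∂μ))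

/-- `X` Lipschitz dominates `Y`: there are a `1`-Lipschitz map `p : Supp μX → Supp μY` and
`c ≥ 1` with `p_*(μX) = c • μY`. -/
def LipDom {X Y : Type*} [MetricSpace X] [MeasurableSpace X] [MetricSpace Y] [MeasurableSpace Y]
    (μX : Measure X) (μY : Measure Y) : Prop :=
  ∃ (p : msupport μX → msupport μY) (c : ℝ), 1 ≤ c ∧
    (∀ a b : msupport μX, dist (p a) (p b) ≤ dist a b) ∧
    Measure.map p (Measure.comap Subtype.val μX)
      = (ENNReal.ofReal c) • Measure.comap Subtype.val μY

end

/-- If each of two sets of nonnegative reals dominates the other, up to a factor `α` in one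
direction, then so do their infima. -/
theorem sInf_scaling_bounds {S S' : Set ℝ} {α : ℝ} (hα : 0 < α)
    (h0 : ∀ r ∈ S, 0 ≤ r) (h0' : ∀ r ∈ S', 0 ≤ r)
    (hle : ∀ r ∈ S, ∃ r' ∈ S', r' ≤ r) (hge : ∀ r' ∈ S', ∃ r ∈ S, α * r ≤ r') :
    α * sInf S ≤ sInf S' ∧ sInf S' ≤ sInf S := by
  rcases S.eq_empty_or_nonempty with rfl | hS
  · have hS' : S' = ∅ := by
      refine Set.eq_empty_of_forall_notMem fun r' hr' => ?_
      obtain ⟨r, hr, -⟩ := hge r' hr'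
      exact hr
    simp [hS']
  have hS' : S'.Nonempty := by
    obtain ⟨r, hr⟩ := hS
    obtain ⟨r', hr', -⟩ := hle r hr
    exact ⟨r', hr'⟩
  constructor
  · refine le_csInf hS' fun r' hr' => ?_
    obtain ⟨r, hr, hrr⟩ := hge r' hr'
    exact (mul_le_mul_of_nonneg_left (csInf_le ⟨0, h0⟩ hr) hα.le).trans hrr
  · refine le_csInf hS fun r hr => ?_
    obtain ⟨r', hr', hrr⟩ := hle r hr
    exact (csInf_le ⟨0, h0'⟩ hr').trans hrr

theorem meDist_smul_bounds {β : Type*} [MeasurableSpace β] (μ : Measure β) [IsFiniteMeasure μ]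
    {lam α : ℝ} (hα0 : 0 < α) (hα1 : α ≤ 1) (f g : β → ℝ) :
    α * meDist μ lam f g ≤ meDist (ENNReal.ofReal α • μ) lam f g ∧
      meDist (ENNReal.ofReal α • μ) lam f g ≤ meDist μ lam f g := by
  have key : ∀ A : Set β, ((ENNReal.ofReal α • μ) A).toReal = α * (μ A).toReal := fun A => by
    simp [ENNReal.toReal_ofReal hα0.le]
  refine sInf_scaling_bounds hα0 (fun r hr => hr.1.le) (fun r hr => hr.1.le) ?_ ?_
  · rintro ε ⟨hε, h⟩
    refine ⟨ε, ⟨hε, ?_⟩, le_rfl⟩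
    rw [key]
    exact (mul_le_of_le_one_left ENNReal.toReal_nonneg hα1).trans h
  · rintro ε ⟨hε, h⟩
    rw [key] at h
    refine ⟨ε / α, ⟨div_pos hε hα0, ?_⟩, (mul_div_cancel₀ ε hα0.ne').le⟩
    have hmono : (μ {x | ε / α ≤ |f x - g x|}).toReal ≤ (μ {x | ε ≤ |f x - g x|}).toReal :=
      ENNReal.toReal_mono (measure_ne_top _ _) <| measure_mono fun x hx =>
        (le_div_self hε.le hα0 hα1).trans hx
    refine hmono.trans ?_
    rw [← mul_div_assoc, le_div_iff₀ hα0]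
    linarith

theorem HL_smul_bounds {β : Type*} [MeasurableSpace β] (μ : Measure β) [IsFiniteMeasure μ]
    {lam α : ℝ} (hα0 : 0 < α) (hα1 : α ≤ 1) (d d' : β → β → ℝ) :
    α * HL μ lam d d' ≤ HL (ENNReal.ofReal α • μ) lam d d' ∧
      HL (ENNReal.ofReal α • μ) lam d d' ≤ HL μ lam d d' := by
  have hme := fun f g : β → ℝ => meDist_smul_bounds μ (lam := lam) hα0 hα1 f g
  refine sInf_scaling_bounds hα0 (fun r hr => hr.1.le) (fun r hr => hr.1.le) ?_ ?_
  · rintro ε ⟨hε, h₁, h₂⟩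
    refine ⟨ε, ⟨hε, fun f hf => ?_, fun g hg => ?_⟩, le_rfl⟩
    · obtain ⟨g, hg, hfg⟩ := h₁ f hf
      exact ⟨g, hg, (hme f g).2.trans hfg⟩
    · obtain ⟨f, hf, hfg⟩ := h₂ g hg
      exact ⟨f, hf, (hme f g).2.trans hfg⟩
  · rintro ε ⟨hε, h₁, h₂⟩
    refine ⟨ε / α, ⟨div_pos hε hα0, fun f hf => ?_, fun g hg => ?_⟩,
      (mul_div_cancel₀ ε hα0.ne').le⟩
    · obtain ⟨g, hg, hfg⟩ := h₁ f hf
      exact ⟨g, hg, (le_div_iff₀' hα0).2 ((hme f g).1.trans hfg)⟩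
    · obtain ⟨f, hf, hfg⟩ := h₂ g hg
      exact ⟨f, hf, (le_div_iff₀' hα0).2 ((hme f g).1.trans hfg)⟩

theorem HL_nonneg {β : Type*} [MeasurableSpace β] (μ : Measure β) (lam : ℝ) (d d' : β → β → ℝ) :
    0 ≤ HL μ lam d d' :=
  Real.sInf_nonneg fun _ hr => hr.1.le

theorem Lip1_comp {β γ : Type*} (e : β ≃ γ) (d : γ → γ → ℝ) (f : γ → ℝ) :
    f ∘ e ∈ Lip1 (fun s t => d (e s) (e t)) ↔ f ∈ Lip1 d := by
  simp only [Lip1, mem_ofPred_eq, Function.comp_apply]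
  exact e.forall_congr fun x => e.forall_congr fun y => Iff.rfl

theorem meDist_comp {β γ : Type*} [MeasurableSpace β] [MeasurableSpace γ] (e : β ≃ᵐ γ)
    (μ : Measure β) (lam : ℝ) (f g : γ → ℝ) :
    meDist μ lam (f ∘ e) (g ∘ e) = meDist (μ.map e) lam f g := by
  simp only [meDist, e.map_apply, preimage_ofPred_eq, Function.comp_apply]

theorem HL_comp {β γ : Type*} [MeasurableSpace β] [MeasurableSpace γ] (e : β ≃ᵐ γ)
    (μ : Measure β) (lam : ℝ) (d d' : γ → γ → ℝ) :
    HL μ lam (fun s t => d (e s) (e t)) (fun s t => d' (e s) (e t)) = HL (μ.map e) lam d d' := by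
  have hsurj : Function.Surjective fun f : γ → ℝ => f ∘ e := fun h =>
    ⟨h ∘ e.symm, by ext; simp⟩
  have hL := fun (d : γ → γ → ℝ) (f : γ → ℝ) => Lip1_comp e.toEquiv d f
  simp only [MeasurableEquiv.coe_toEquiv] at hL
  simp only [HL, hsurj.forall, hsurj.exists, hL, meDist_comp]

/-- Multiplication by `α⁻¹`, as a measurable equivalence of the line. -/
noncomputable def invScale {α : ℝ} (hα : 0 < α) : ℝ ≃ᵐ ℝ :=
  (Homeomorph.mulLeft₀ α⁻¹ (inv_ne_zero hα.ne')).toMeasurableEquiv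

theorem map_invScale_lebIcc {α : ℝ} (hα : 0 < α) (m : ℝ) :
    (lebIcc (α * m)).map (invScale hα) = ENNReal.ofReal α • lebIcc m := by
  have hpre : invScale hα ⁻¹' Icc 0 m = Icc 0 (α * m) := by
    ext x
    change 0 ≤ α⁻¹ * x ∧ α⁻¹ * x ≤ m ↔ 0 ≤ x ∧ x ≤ α * m
    rw [mul_nonneg_iff_of_pos_left (inv_pos.2 hα), inv_mul_le_iff₀ hα]
  have hmap : (volume : Measure ℝ).map (invScale hα) = ENNReal.ofReal α • volume := by
    have := Real.map_volume_mul_left (inv_ne_zero hα.ne')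
    rwa [inv_inv, abs_of_pos hα] at this
  rw [lebIcc, lebIcc, ← hpre, ← MeasurableEquiv.restrict_map, hmap, Measure.restrict_smul]

theorem isParameter_smul_comp_iff {X : Type*} [MeasurableSpace X] (μ : Measure X) {α : ℝ}
    (hα : 0 < α) (m : ℝ) (φ : ℝ → X) :
    IsParameter (ENNReal.ofReal α • μ) (α * m) (φ ∘ invScale hα) ↔ IsParameter μ m φ := by
  have h0 : ENNReal.ofReal α ≠ 0 := by simpa using hα
  have hinj : ∀ μ ν : Measure X,
      ENNReal.ofReal α • μ = ENNReal.ofReal α • ν ↔ μ = ν := fun μ ν => by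
    refine ⟨fun h => Measure.ext fun s _ => ?_, fun h => h ▸ rfl⟩
    have hs := congrArg (fun ρ : Measure X => ρ s) h
    simpa [ENNReal.mul_right_inj h0 ENNReal.ofReal_ne_top] using hs
  unfold IsParameter
  rw [MeasurableEquiv.measurable_comp_iff]
  refine and_congr_right fun hφ => ?_
  rw [← Measure.map_map hφ (invScale hα).measurable, map_invScale_lebIcc, Measure.map_smul, hinj]

theorem obsInf_smul_bounds {X Y : Type*} [PseudoMetricSpace X] [MeasurableSpace X]
    [PseudoMetricSpace Y] [MeasurableSpace Y] (μX : Measure X) (μY : Measure Y) (lam m : ℝ)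
    {α : ℝ} (hα0 : 0 < α) (hα1 : α ≤ 1) :
    α * obsInf lam m μX μY ≤
        obsInf lam (α * m) (ENNReal.ofReal α • μX) (ENNReal.ofReal α • μY) ∧
      obsInf lam (α * m) (ENNReal.ofReal α • μX) (ENNReal.ofReal α • μY) ≤
        obsInf lam m μX μY := by
  have : IsFiniteMeasure (lebIcc m) := by unfold lebIcc; infer_instance
  have hHL : ∀ (φX : ℝ → X) (φY : ℝ → Y),
      HL (lebIcc (α * m)) lam (pb (φX ∘ invScale hα0)) (pb (φY ∘ invScale hα0)) =
        HL (ENNReal.ofReal α • lebIcc m) lam (pb φX) (pb φY) := fun φX φY => by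
    rw [← map_invScale_lebIcc hα0]
    exact HL_comp (invScale hα0) _ lam (pb φX) (pb φY)
  refine sInf_scaling_bounds hα0 ?_ ?_ ?_ ?_
  · rintro _ ⟨φX, φY, -, -, rfl⟩
    exact HL_nonneg ..
  · rintro _ ⟨φX, φY, -, -, rfl⟩
    exact HL_nonneg ..
  · rintro _ ⟨φX, φY, hX, hY, rfl⟩
    refine ⟨_, ⟨φX ∘ invScale hα0, φY ∘ invScale hα0,
      (isParameter_smul_comp_iff μX hα0 m φX).2 hX,
      (isParameter_smul_comp_iff μY hα0 m φY).2 hY, rfl⟩, ?_⟩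
    rw [hHL]
    exact (HL_smul_bounds _ hα0 hα1 _ _).2
  · rintro _ ⟨ψX, ψY, hX, hY, rfl⟩
    obtain ⟨φX, rfl⟩ : ∃ φ, ψX = φ ∘ invScale hα0 :=
      ⟨ψX ∘ (invScale hα0).symm, by ext; simp⟩
    obtain ⟨φY, rfl⟩ : ∃ φ, ψY = φ ∘ invScale hα0 :=
      ⟨ψY ∘ (invScale hα0).symm, by ext; simp⟩
    refine ⟨_, ⟨φX, φY, (isParameter_smul_comp_iff μX hα0 m φX).1 hX,
      (isParameter_smul_comp_iff μY hα0 m φY).1 hY, rfl⟩, ?_⟩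
    rw [hHL]
    exact (HL_smul_bounds _ hα0 hα1 _ _).1

/-- scaling of the observable distance. -/
theorem obs_scaling {X Y : Type*}
    [MetricSpace X] [CompleteSpace X] [TopologicalSpace.SeparableSpace X]
    [MeasurableSpace X] [BorelSpace X]
    [MetricSpace Y] [CompleteSpace Y] [TopologicalSpace.SeparableSpace Y]
    [MeasurableSpace Y] [BorelSpace Y]
    (μX : Measure X) (μY : Measure Y) [IsFiniteMeasure μX] [IsFiniteMeasure μY]
    (lam : ℝ) (hlam : 0 ≤ lam) (hm : μX univ = μY univ)
    (α : ℝ) (hα0 : 0 < α) (hα1 : α ≤ 1) :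
    α * mmObs lam μX μY ≤
        mmObs lam ((ENNReal.ofReal α) • μX) ((ENNReal.ofReal α) • μY) ∧
      mmObs lam ((ENNReal.ofReal α) • μX) ((ENNReal.ofReal α) • μY) ≤ mmObs lam μX μY := by
  have hmass : ((ENNReal.ofReal α • μX) univ).toReal = α * (μX univ).toReal := by
    simp [ENNReal.toReal_ofReal hα0.le]
  have hmass' : ((ENNReal.ofReal α • μY) univ).toReal = α * (μX univ).toReal := by
    simp [ENNReal.toReal_ofReal hα0.le, hm]
  unfold mmObs
  rw [if_pos (congrArg ENNReal.toReal hm), if_pos (hmass.trans hmass'.symm), hmass]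
  exact obsInf_smul_bounds μX μY lam _ hα0 hα1
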